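/- Let σ > 0, θ₀, θ₁ ∈ ℝ and γ ∈ [0,1]. Then the B = 0 limiting form of the S-divergence between equal-variance normal densities satisfies ∫_ℝ φ_{θ₁,σ}^{1+γ} · log(φ_{θ₁,σ}/φ_{θ₀,σ}) dx − (1/(1+γ)) ∫_ℝ (φ_{θ₁,σ}^{1+γ} − φ_{θ₀,σ}^{1+γ}) dx = κ_γ · (θ₁ − θ₀)² / (2σ²), where κ_γ = (2π)^{−γ/2}·σ^{−γ}·(1+γ)^{−1/2}. (In particular, for γ = 0 this recovers the Kullback–Leibler divergence (θ₁−θ₀)²/(2σ²), so the test statistic reduces to the likelihood ratio test statistic.) -/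

import Mathlib

open MeasureTheory Real

/-- The density of N(θ, σ²) on ℝ. -/
noncomputable def normalPDF (θ σ : ℝ) (x : ℝ) : ℝ :=
  (Real.sqrt (2 * Real.pi) * σ)⁻¹ * Real.exp (-(x - θ) ^ 2 / (2 * σ ^ 2))

theorem normalPDF_rpow (θ : ℝ) {σ : ℝ} (hσ : 0 < σ) (p x : ℝ) :
    normalPDF θ σ x ^ p
      = (√(2 * π) * σ)⁻¹ ^ p * exp (-(p / (2 * σ ^ 2)) * (x - θ) ^ 2) := by
  unfold normalPDF
  rw [mul_rpow (by positivity) (exp_pos _).le, ← exp_mul]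
  congr 2
  ring

theorem log_normalPDF_div (θ₀ θ₁ : ℝ) {σ : ℝ} (hσ : 0 < σ) (x : ℝ) :
    log (normalPDF θ₁ σ x / normalPDF θ₀ σ x)
      = (θ₁ - θ₀) / σ ^ 2 * (x - θ₁) + (θ₁ - θ₀) ^ 2 / (2 * σ ^ 2) := by
  unfold normalPDF
  rw [mul_div_mul_left _ _ (by positivity), ← exp_sub, log_exp]
  field_simp
  ring

theorem integrable_normalPDF_rpow (θ : ℝ) {σ p : ℝ} (hσ : 0 < σ) (hp : 0 < p) :
    Integrable fun x ↦ normalPDF θ σ x ^ p := by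
  simp_rw [normalPDF_rpow θ hσ]
  exact ((integrable_exp_neg_mul_sq (by positivity)).comp_sub_right θ).const_mul _

theorem integral_normalPDF_rpow (θ : ℝ) {σ p : ℝ} (hσ : 0 < σ) (hp : 0 < p) :
    ∫ x, normalPDF θ σ x ^ p
      = (2 * π) ^ ((1 - p) / 2) * σ ^ (1 - p) * p ^ (-(1 : ℝ) / 2) := by
  simp_rw [normalPDF_rpow θ hσ]
  rw [integral_const_mul,
    integral_sub_right_eq_self (fun x ↦ exp (-(p / (2 * σ ^ 2)) * x ^ 2)) θ, integral_gaussian]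
  have h : π / (p / (2 * σ ^ 2)) = 2 * π * σ ^ 2 * p⁻¹ := by field_simp
  have hσ' : (σ ^ 2) ^ (1 / 2 : ℝ) = σ := by
    rw [← sqrt_eq_rpow, sqrt_sq hσ.le]
  have h2π : 0 < 2 * π := by positivity
  rw [h, inv_rpow (by positivity), ← rpow_neg (by positivity), mul_rpow (by positivity) hσ.le,
    sqrt_eq_rpow, sqrt_eq_rpow, ← rpow_mul h2π.le,
    mul_rpow (x := 2 * π * σ ^ 2) (by positivity) (by positivity),
    mul_rpow (x := 2 * π) h2π.le (by positivity), hσ', inv_rpow hp.le, ← rpow_neg hp.le,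
    show (1 - p) / 2 = 1 / 2 * -p + 1 / 2 by ring, rpow_add h2π,
    show 1 - p = -p + 1 by ring, rpow_add hσ, rpow_one, neg_div]
  ring

theorem integrable_normalPDF_rpow_mul_sub (θ : ℝ) {σ p : ℝ} (hσ : 0 < σ) (hp : 0 < p) :
    Integrable fun x ↦ normalPDF θ σ x ^ p * (x - θ) := by
  simp_rw [normalPDF_rpow θ hσ]
  convert ((integrable_mul_exp_neg_mul_sq
    (show 0 < p / (2 * σ ^ 2) by positivity)).comp_sub_right θ).const_mul
      ((√(2 * π) * σ)⁻¹ ^ p) using 2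
  ring

theorem integral_normalPDF_rpow_mul_sub (θ : ℝ) {σ : ℝ} (hσ : 0 < σ) (p : ℝ) :
    ∫ x, normalPDF θ σ x ^ p * (x - θ) = 0 := by
  have h := integral_sub_left_eq_self (fun x ↦ normalPDF θ σ x ^ p * (x - θ)) volume (2 * θ)
  have hneg (x : ℝ) : normalPDF θ σ (2 * θ - x) ^ p * (2 * θ - x - θ)
      = -(normalPDF θ σ x ^ p * (x - θ)) := by
    have : (2 * θ - x - θ) ^ 2 = (x - θ) ^ 2 := by ring
    rw [normalPDF_rpow θ hσ, normalPDF_rpow θ hσ, this]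
    ring
  simp_rw [hneg] at h
  rw [integral_neg] at h
  linarith

/-- The B = 0 limiting form of the S-divergence between equal-variance normal
densities equals κ_γ (θ₁ − θ₀)²/(2σ²). -/
theorem S_div_normal_B_zero (σ θ₀ θ₁ γ : ℝ) (hσ : 0 < σ)
    (hγ0 : 0 ≤ γ) (hγ1 : γ ≤ 1) :
    (∫ x : ℝ, (normalPDF θ₁ σ x) ^ (1 + γ)
        * Real.log (normalPDF θ₁ σ x / normalPDF θ₀ σ x))
      - (1 / (1 + γ))
        * ∫ x : ℝ, ((normalPDF θ₁ σ x) ^ (1 + γ) - (normalPDF θ₀ σ x) ^ (1 + γ))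
    = ((2 * Real.pi) ^ (-γ / 2) * σ ^ (-γ) * (1 + γ) ^ (-(1 : ℝ) / 2))
        * (θ₁ - θ₀) ^ 2 / (2 * σ ^ 2) := by
  have hp : 0 < 1 + γ := by linarith
  have hlog (x : ℝ) : normalPDF θ₁ σ x ^ (1 + γ) * log (normalPDF θ₁ σ x / normalPDF θ₀ σ x)
      = (θ₁ - θ₀) / σ ^ 2 * (normalPDF θ₁ σ x ^ (1 + γ) * (x - θ₁))
        + (θ₁ - θ₀) ^ 2 / (2 * σ ^ 2) * normalPDF θ₁ σ x ^ (1 + γ) := by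
    rw [log_normalPDF_div θ₀ θ₁ hσ]
    ring
  simp_rw [hlog]
  rw [integral_add ((integrable_normalPDF_rpow_mul_sub θ₁ hσ hp).const_mul _)
      ((integrable_normalPDF_rpow θ₁ hσ hp).const_mul _),
    integral_const_mul, integral_const_mul, integral_normalPDF_rpow_mul_sub θ₁ hσ,
    integral_sub (integrable_normalPDF_rpow θ₁ hσ hp) (integrable_normalPDF_rpow θ₀ hσ hp),
    integral_normalPDF_rpow θ₁ hσ hp, integral_normalPDF_rpow θ₀ hσ hp,
    show 1 - (1 + γ) = -γ by ring]
  ring
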